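/- Let c : 𝕊¹ → ℝ² be a smooth embedding of the circle into the plane (c is injective, smooth, and an immersion: its derivative is nowhere vanishing). Then there exists ε > 0 and a smooth injective map F : 𝕊¹ × [−ε, ε] → ℝ² with F(z, 0) = c(z) for all z ∈ 𝕊¹, such that F is area preserving: the pushforward under F of the product of the (2π-normalized, i.e. arc-length) Haar measure on 𝕊¹ with Lebesgue measure on [−ε, ε] equals the restriction of Lebesgue measure on ℝ² to the range of F. -/

import Mathlib

open MeasureTheory Manifold

noncomputable instance : MeasurableSpace Circle := borel Circle
instance : BorelSpace Circle := ⟨rfl⟩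

/-- The arc-length measure on the circle (the `2π`-normalized Haar measure), obtained by
pushing Lebesgue measure on `[0, 2π)` forward along `t ↦ exp(i t)`. -/
noncomputable def arcLengthMeasure : Measure Circle :=
  Measure.map (⇑Circle.exp) (volume.restrict (Set.Ico 0 (2 * Real.pi)))

open scoped ContDiff Topology

/-- A smooth function on the whole line solving `h + u h² / 2 = 1` for small `u`. -/
theorem exists_contDiff_add_mul_sq_eq_one :
    ∃ h : ℝ → ℝ, ContDiff ℝ ∞ h ∧
      ∃ δ > 0, ∀ u : ℝ, |u| < δ → h u + u * h u ^ 2 / 2 = 1 := by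
  let χ : ContDiffBump (0 : ℝ) := ⟨1 / 8, 1 / 4, by norm_num, by norm_num⟩
  have hpos (u : ℝ) : 0 < 1 + 2 * (u * χ u) := by
    by_cases hu : |u| < 1 / 4
    · have h0 := χ.nonneg (x := u)
      have h1 := χ.le_one (x := u)
      have := abs_lt.1 hu
      nlinarith
    · have : χ u = 0 := χ.zero_of_le_dist (by
      simpa only [Real.dist_eq, sub_zero] using not_lt.1 hu)
      simp [this]
  have hsq (u : ℝ) : 0 < 1 + √(1 + 2 * (u * χ u)) := by positivity
  refine ⟨fun u ↦ 2 / (1 + √(1 + 2 * (u * χ u))), ?_, 1 / 8, by norm_num, fun u hu ↦ ?_⟩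
  · refine contDiff_const.div (contDiff_const.add (ContDiff.sqrt ?_ fun u ↦ (hpos u).ne'))
      fun u ↦ (hsq u).ne'
    exact contDiff_const.add (contDiff_const.mul (contDiff_id.mul χ.contDiff))
  · have hχ : χ u = 1 := χ.one_of_mem_closedBall (by
      simpa only [Metric.mem_closedBall, Real.dist_eq, sub_zero] using hu.le)
    have h1 := hsq u
    have h2 := Real.sq_sqrt (hpos u).le
    simp only [hχ, mul_one] at h1 h2 ⊢
    generalize √(1 + 2 * u) = r at h1 h2 ⊢
    obtain rfl : u = (r ^ 2 - 1) / 2 := by linarith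
    field_simp
    ring

theorem ContinuousLinearMap.det_prod_eq (L : ℝ × ℝ →L[ℝ] ℝ × ℝ) :
    L.det = (L (1, 0)).1 * (L (0, 1)).2 - (L (0, 1)).1 * (L (1, 0)).2 := by
  rw [ContinuousLinearMap.det, ← LinearMap.det_toMatrix (Module.Basis.finTwoProd ℝ),
    Matrix.det_fin_two]
  simp [LinearMap.toMatrix_apply]

theorem Function.Periodic.deriv_real {f : ℝ → ℝ} {T : ℝ} (hf : Function.Periodic f T) :
    Function.Periodic (deriv f) T := fun t ↦ by
  rw [← deriv_comp_add_const, funext hf]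

theorem Circle.contMDiff_coe : ContMDiff (𝓡 1) 𝓘(ℝ, ℂ) ∞ (fun z : Circle ↦ (z : ℂ)) :=
  haveI : Fact (Module.finrank ℝ ℂ = 1 + 1) := finrank_real_complex_fact'
  contMDiff_coe_sphere (E := ℂ)

/-- `Circle.exp` has a global section which is smooth at a prescribed point. -/
theorem Circle.exists_contMDiffAt_lift (z₀ : Circle) :
    ∃ σ : Circle → ℝ, ContMDiffAt (𝓡 1) 𝓘(ℝ, ℝ) ∞ σ z₀ ∧ ∀ z, Circle.exp (σ z) = z := by
  refine ⟨fun z ↦ Complex.arg z₀ + Complex.arg (z * z₀⁻¹ : Circle), ?_, fun z ↦ by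
    rw [Circle.exp_add, Circle.exp_arg, Circle.exp_arg, mul_comm, inv_mul_cancel_right]⟩
  have hmul : ContMDiff (𝓡 1) (𝓡 1) ∞ (fun z : Circle ↦ z * z₀⁻¹) := contMDiff_mul_right
  have hlog : ContDiffAt ℝ ∞ (fun w : ℂ ↦ Complex.arg z₀ + Complex.arg w)
      ((z₀ * z₀⁻¹ : Circle) : ℂ) := by
    simp only [← Complex.log_im _]
    exact contDiffAt_const.add (Complex.imCLM.contDiff.contDiffAt.comp _
      ((Complex.contDiffAt_log (by simp)).restrict_scalars ℝ))
  exact ContMDiffAt.comp (g := fun w : ℂ ↦ Complex.arg z₀ + Complex.arg w) z₀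
    hlog.contMDiffAt (Circle.contMDiff_coe.comp hmul).contMDiffAt

/-- If `(a, b)` is transverse to the curve `(x, y)` with determinant one, then displacing the curve
along `(a, b)` by a suitable solution `g` of a quadratic equation preserves area. -/
theorem det_fderiv_add_mul_eq_one {x y a b : ℝ → ℝ} {g : ℝ × ℝ → ℝ} {t s : ℝ}
    (hx : DifferentiableAt ℝ x t) (hy : DifferentiableAt ℝ y t)
    (ha : DifferentiableAt ℝ a t) (hb : DifferentiableAt ℝ b t)
    (hg : DifferentiableAt ℝ g (t, s))
    (hdet : deriv x t * b t - deriv y t * a t = 1)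
    (hgs : ∀ᶠ r in 𝓝 s, g (t, r) +
      (deriv a t * b t - deriv b t * a t) * g (t, r) ^ 2 / 2 = r) :
    (fderiv ℝ (fun p : ℝ × ℝ ↦ (x p.1 + g p * a p.1, y p.1 + g p * b p.1)) (t, s)).det = 1 := by
  have hF : DifferentiableAt ℝ
      (fun p : ℝ × ℝ ↦ (x p.1 + g p * a p.1, y p.1 + g p * b p.1)) (t, s) := by
    have h1 {f : ℝ → ℝ} (hf : DifferentiableAt ℝ f t) :
        DifferentiableAt ℝ (fun p : ℝ × ℝ ↦ f p.1) (t, s) :=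
      DifferentiableAt.comp (t, s) hf differentiableAt_fst
    exact ((h1 hx).add (hg.mul (h1 ha))).prodMk ((h1 hy).add (hg.mul (h1 hb)))
  have hl : HasDerivAt (fun r : ℝ ↦ (r, s)) (1, 0) t :=
    (hasDerivAt_id t).prodMk (hasDerivAt_const t s)
  have hr : HasDerivAt (fun r : ℝ ↦ (t, r)) (0, 1) s :=
    (hasDerivAt_const s t).prodMk (hasDerivAt_id s)
  have hgl := hg.hasFDerivAt.comp_hasDerivAt t hl
  have hgr := hg.hasFDerivAt.comp_hasDerivAt s hr
  have h10 := (hF.hasFDerivAt.comp_hasDerivAt t hl).unique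
    ((hx.hasDerivAt.add (hgl.mul ha.hasDerivAt)).prodMk
      (hy.hasDerivAt.add (hgl.mul hb.hasDerivAt)))
  have h01 := (hF.hasFDerivAt.comp_hasDerivAt s hr).unique
    (((hgr.mul_const (a t)).const_add (x t)).prodMk ((hgr.mul_const (b t)).const_add (y t)))
  have hd := (((hgr.add (((hgr.pow 2).const_mul _).div_const 2)).congr_of_eventuallyEq
    (f₁ := id) (hgs.mono fun r hr ↦ hr.symm)).unique (hasDerivAt_id s))
  rw [ContinuousLinearMap.det_prod_eq, h10, h01]
  simp only [Function.comp_apply] at hd ⊢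
  linear_combination hd + fderiv ℝ g (t, s) (0, 1) * hdet

/-- Smooth maps on `ℝ × ℝ` that descend to `Circle × ℝ` descend to smooth maps. -/
theorem contMDiff_of_comp_circleExp {Φ : ℝ × ℝ → ℝ × ℝ} (hΦ : ContDiff ℝ ∞ Φ)
    {F : Circle × ℝ → ℝ × ℝ} (hF : ∀ t s, F (Circle.exp t, s) = Φ (t, s)) :
    ContMDiff ((𝓡 1).prod 𝓘(ℝ, ℝ)) 𝓘(ℝ, ℝ × ℝ) ∞ F := by
  rintro ⟨z, s⟩
  obtain ⟨σ, hσ, hexp⟩ := Circle.exists_contMDiffAt_lift z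
  have h : F = Φ ∘ fun q : Circle × ℝ ↦ (σ q.1, q.2) := by
    ext1 ⟨w, r⟩
    simp [← hF, hexp]
  rw [h]
  refine ContMDiffAt.comp (I' := 𝓘(ℝ, ℝ × ℝ)) _ hΦ.contMDiff.contMDiffAt ?_
  exact ContMDiffAt.prodMk_space (ContMDiffAt.comp (z, s) hσ contMDiffAt_fst) contMDiffAt_snd

theorem deriv_comp_circleExp_ne_zero {c : Circle → ℝ × ℝ}
    (hc : ContMDiff (𝓡 1) 𝓘(ℝ, ℝ × ℝ) ∞ c) {t : ℝ}
    (hc_imm : mfderiv (𝓡 1) 𝓘(ℝ, ℝ × ℝ) c (Circle.exp t) ≠ 0) :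
    deriv (fun t ↦ c (Circle.exp t)) t ≠ 0 := by
  have hγ : ContDiff ℝ ∞ (fun t ↦ c (Circle.exp t)) := (hc.comp contMDiff_circleExp).contDiff
  intro h0
  apply hc_imm
  obtain ⟨σ, hσ, hexp⟩ := Circle.exists_contMDiffAt_lift (Circle.exp t)
  have h : c = (fun t ↦ c (Circle.exp t)) ∘ σ := by
    ext1 w
    simp [hexp]
  obtain ⟨m, hm⟩ := Circle.exp_eq_exp.1 (hexp (Circle.exp t))
  have hper : Function.Periodic (fun t ↦ c (Circle.exp t)) (m * (2 * Real.pi)) := fun r ↦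
    congrArg c (Circle.exp_eq_exp.2 ⟨m, rfl⟩)
  have h1 : fderiv ℝ (fun t ↦ c (Circle.exp t)) (σ (Circle.exp t)) = 0 := by
    ext1
    rw [fderiv_apply_one_eq_deriv, hm, ← deriv_comp_add_const, funext hper, h0]
    rfl
  rw [h, mfderiv_comp (I' := 𝓘(ℝ, ℝ)) _ (hγ.contMDiff.mdifferentiable (by simp) _)
    (hσ.mdifferentiableAt (by simp)), mfderiv_eq_fderiv, h1]
  exact ContinuousLinearMap.zero_comp _

theorem map_restrict_of_abs_det_fderiv_eq_one {V : Type*} [NormedAddCommGroup V]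
    [NormedSpace ℝ V] [FiniteDimensional ℝ V] [MeasurableSpace V] [BorelSpace V]
    {μ : Measure V} [μ.IsAddHaarMeasure] {Φ : V → V} (hΦ : Differentiable ℝ Φ)
    {s : Set V} (hs : MeasurableSet s) (hinj : Set.InjOn Φ s)
    (hdet : ∀ p ∈ s, |(fderiv ℝ Φ p).det| = 1) :
    Measure.map Φ (μ.restrict s) = μ.restrict (Φ '' s) := by
  have h : (fun p ↦ ENNReal.ofReal |(fderiv ℝ Φ p).det|) =ᵐ[μ.restrict s] 1 :=
    (ae_restrict_mem hs).mono fun p hp ↦ by simp [hdet p hp]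
  rw [← map_withDensity_abs_det_fderiv_eq_addHaar μ hs.nullMeasurableSet
      (fun p _ ↦ (hΦ p).hasFDerivAt.hasFDerivWithinAt) hinj,
    withDensity_congr_ae h, withDensity_one]

theorem exists_injOn_map_prod_eq_restrict {Φ : ℝ × ℝ → ℝ × ℝ} (hΦ : ContDiff ℝ ∞ Φ)
    {F : Circle × ℝ → ℝ × ℝ} (hF : ∀ t s, F (Circle.exp t, s) = Φ (t, s))
    (hinj : Function.Injective fun z ↦ F (z, 0)) {ρ : ℝ} (hρ : 0 < ρ)
    (hdet : ∀ t ∈ Set.Icc 0 (2 * Real.pi), ∀ s, |s| < ρ → (fderiv ℝ Φ (t, s)).det = 1) :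
    ∃ ε : ℝ, 0 < ε ∧ Set.InjOn F (Set.univ ×ˢ Set.Icc (-ε) ε) ∧
      Measure.map F (arcLengthMeasure.prod (volume.restrict (Set.Icc (-ε) ε)))
        = volume.restrict (F '' (Set.univ ×ˢ Set.Icc (-ε) ε)) := by
  let E : ℝ × ℝ → Circle × ℝ := Prod.map Circle.exp id
  have hFE : F ∘ E = Φ := funext fun p ↦ hF p.1 p.2
  have hFc : Continuous F := (contMDiff_of_comp_circleExp hΦ hF).continuous
  have hEo : IsOpenMap E := isLocalHomeomorph_circleExp.isOpenMap.prodMap IsOpenMap.id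
  have hEs {z : Circle} : ∃ t ∈ Set.Ico 0 (2 * Real.pi), Circle.exp t = z := by
    obtain ⟨t, rfl⟩ := Circle.exp_surjective z
    obtain ⟨r, hr, h⟩ := Circle.periodic_exp.exists_mem_Ico₀ Real.two_pi_pos t
    exact ⟨r, hr, h.symm⟩
  have hloc : ∀ q ∈ (Set.univ : Set Circle) ×ˢ ({0} : Set ℝ), ∃ u ∈ 𝓝 q, Set.InjOn F u := by
    rintro ⟨z, s⟩ ⟨-, rfl : s = 0⟩
    obtain ⟨t, ht, rfl⟩ := hEs (z := z)
    have hd := hdet t (Set.Ico_subset_Icc_self ht) 0 (by simpa using hρ)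
    have hs := (hΦ.contDiffAt (x := (t, 0))).hasStrictFDerivAt (by simp)
    have hu : IsUnit (fderiv ℝ Φ (t, 0)).det := by rw [hd]; exact isUnit_one
    rw [← ContinuousLinearMap.coe_toContinuousLinearEquivOfDetNeZero _ hu.ne_zero] at hs
    let e := hs.toOpenPartialHomeomorph Φ
    have hmem := hs.mem_toOpenPartialHomeomorph_source
    refine ⟨E '' e.source, hEo.image_mem_nhds (x := (t, 0)) (e.open_source.mem_nhds hmem), ?_⟩
    rintro _ ⟨p, hp, rfl⟩ _ ⟨q, hq, rfl⟩ hpq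
    refine congrArg E (e.injOn hp hq ?_)
    change Φ p = Φ q
    rwa [← hFE]
  have hinj0 : Set.InjOn F ((Set.univ : Set Circle) ×ˢ ({0} : Set ℝ)) := by
    rintro ⟨z, s⟩ ⟨-, rfl : s = 0⟩ ⟨w, r⟩ ⟨-, rfl : r = 0⟩ h
    rw [hinj h]
  obtain ⟨u, hu, hFu⟩ := hinj0.exists_mem_nhdsSet (isCompact_univ.prod isCompact_singleton)
    (fun _ _ ↦ hFc.continuousAt) hloc
  obtain ⟨o, huo, ho, hou⟩ := mem_nhdsSet_iff_exists.1 hu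
  obtain ⟨v, w, -, hw, hv, h0w, hvw⟩ :=
    generalized_tube_lemma isCompact_univ isCompact_singleton huo ho
  obtain ⟨η, hη, hηw⟩ := Metric.isOpen_iff.1 hw 0 (h0w rfl)
  obtain ⟨ε, hε, hlt⟩ := exists_between (lt_min hρ hη)
  have habs {s : ℝ} (hs : s ∈ Set.Icc (-ε) ε) : |s| < min ρ η := (abs_le.2 hs).trans_lt hlt
  have hinjε : Set.InjOn F (Set.univ ×ˢ Set.Icc (-ε) ε) := by
    refine hFu.mono fun q hq ↦ hou (hvw ⟨hv trivial, hηw ?_⟩)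
    simpa using (habs hq.2).trans_le (min_le_right _ _)
  refine ⟨ε, hε, hinjε, ?_⟩
  have hEc : Continuous E := Circle.exp.continuous.prodMap continuous_id
  have himg : E '' (Set.Ico 0 (2 * Real.pi) ×ˢ Set.Icc (-ε) ε) = Set.univ ×ˢ Set.Icc (-ε) ε := by
    rw [Set.prodMap_image_prod, Set.image_id]
    congr 1
    exact Set.eq_univ_of_forall fun z ↦ hEs
  have hinjE : Set.InjOn E (Set.Ico 0 (2 * Real.pi) ×ˢ Set.Icc (-ε) ε) :=
    (Circle.exp_injOn_Ico (by simp)).prodMap (Set.injOn_id _)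
  have hinjΦ : Set.InjOn Φ (Set.Ico 0 (2 * Real.pi) ×ˢ Set.Icc (-ε) ε) := by
    rw [← hFE]
    exact (himg ▸ hinjε).comp hinjE (Set.mapsTo_image _ _)
  have hmeas : MeasurableSet (Set.Ico 0 (2 * Real.pi) ×ˢ Set.Icc (-ε) ε) :=
    measurableSet_Ico.prod measurableSet_Icc
  have harc : arcLengthMeasure.prod (volume.restrict (Set.Icc (-ε) ε)) =
      Measure.map E (volume.restrict (Set.Ico 0 (2 * Real.pi) ×ˢ Set.Icc (-ε) ε)) := by
    rw [Measure.volume_eq_prod, ← Measure.prod_restrict,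
      ← Measure.map_prod_map _ _ Circle.exp.continuous.measurable measurable_id,
      Measure.map_id, arcLengthMeasure]
  rw [harc, Measure.map_map hFc.measurable hEc.measurable, hFE, ← himg, ← Set.image_comp, hFE]
  refine map_restrict_of_abs_det_fderiv_eq_one (hΦ.differentiable (by simp)) hmeas hinjΦ
    fun p hp ↦ ?_
  rw [hdet p.1 (Set.Ico_subset_Icc_self hp.1) p.2 ((habs hp.2).trans_le (min_le_left _ _)),
    abs_one]

/-- A smooth embedding of the circle in the plane extends, for sufficiently small `ε > 0`, to
a smooth injective area-preserving map of the annulus `𝕊¹ × [−ε, ε]` into the plane. -/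
theorem smooth_embedding_extends_area_preserving
    (c : Circle → ℝ × ℝ)
    (hc_smooth : ContMDiff (𝓡 1) 𝓘(ℝ, ℝ × ℝ) (⊤ : ℕ∞) c)
    (hc_inj : Function.Injective c)
    (hc_imm : ∀ z : Circle, mfderiv (𝓡 1) 𝓘(ℝ, ℝ × ℝ) c z ≠ 0) :
    ∃ ε : ℝ, 0 < ε ∧ ∃ F : Circle × ℝ → ℝ × ℝ,
      ContMDiff ((𝓡 1).prod 𝓘(ℝ, ℝ)) 𝓘(ℝ, ℝ × ℝ) (⊤ : ℕ∞) F ∧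
      Set.InjOn F (Set.univ ×ˢ Set.Icc (-ε) ε) ∧
      (∀ z : Circle, F (z, 0) = c z) ∧
      Measure.map F (arcLengthMeasure.prod (volume.restrict (Set.Icc (-ε) ε)))
        = volume.restrict (F '' (Set.univ ×ˢ Set.Icc (-ε) ε)) := by
  have hγ : ContDiff ℝ ∞ (fun t ↦ c (Circle.exp t)) :=
    (hc_smooth.comp contMDiff_circleExp).contDiff
  let x : ℝ → ℝ := fun t ↦ (c (Circle.exp t)).1
  let y : ℝ → ℝ := fun t ↦ (c (Circle.exp t)).2
  have hx : ContDiff ℝ ∞ x := contDiff_fst.comp hγ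
  have hy : ContDiff ℝ ∞ y := contDiff_snd.comp hγ
  have hd {f : ℝ → ℝ} (hf : ContDiff ℝ ∞ f) : Differentiable ℝ f := hf.differentiable (by simp)
  have hx' : ContDiff ℝ ∞ (deriv x) := (contDiff_infty_iff_deriv.1 hx).2
  have hy' : ContDiff ℝ ∞ (deriv y) := (contDiff_infty_iff_deriv.1 hy).2
  have hD (t : ℝ) : deriv x t ^ 2 + deriv y t ^ 2 ≠ 0 := fun h ↦ by
    refine deriv_comp_circleExp_ne_zero hc_smooth (hc_imm (Circle.exp t)) ?_
    have h1 : deriv x t = 0 := by nlinarith [sq_nonneg (deriv x t), sq_nonneg (deriv y t)]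
    have h2 : deriv y t = 0 := by nlinarith [sq_nonneg (deriv x t), sq_nonneg (deriv y t)]
    rw [((hd hx t).hasDerivAt.prodMk (hd hy t).hasDerivAt).deriv, h1, h2]
    rfl
  let a : ℝ → ℝ := fun t ↦ -deriv y t / (deriv x t ^ 2 + deriv y t ^ 2)
  let b : ℝ → ℝ := fun t ↦ deriv x t / (deriv x t ^ 2 + deriv y t ^ 2)
  have ha : ContDiff ℝ ∞ a := hy'.neg.div ((hx'.pow 2).add (hy'.pow 2)) hD
  have hb : ContDiff ℝ ∞ b := hx'.div ((hx'.pow 2).add (hy'.pow 2)) hD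
  have hdet (t : ℝ) : deriv x t * b t - deriv y t * a t = 1 := by
    have := hD t
    simp only [a, b]
    field_simp
    ring
  let k : ℝ → ℝ := fun t ↦ deriv a t * b t - deriv b t * a t
  have hk : ContDiff ℝ ∞ k :=
    ((contDiff_infty_iff_deriv.1 ha).2.mul hb).sub ((contDiff_infty_iff_deriv.1 hb).2.mul ha)
  have hxp : Function.Periodic x (2 * Real.pi) := fun t ↦ by simp [x]
  have hyp : Function.Periodic y (2 * Real.pi) := fun t ↦ by simp [y]
  have hap : Function.Periodic a (2 * Real.pi) := fun t ↦ by
    simp only [a, hxp.deriv_real t, hyp.deriv_real t]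
  have hbp : Function.Periodic b (2 * Real.pi) := fun t ↦ by
    simp only [b, hxp.deriv_real t, hyp.deriv_real t]
  have hkp : Function.Periodic k (2 * Real.pi) := fun t ↦ by
    simp only [k, hap t, hbp t, hap.deriv_real t, hbp.deriv_real t]
  obtain ⟨h, hh, δ, hδ, hh1⟩ := exists_contDiff_add_mul_sq_eq_one
  let g : ℝ × ℝ → ℝ := fun p ↦ p.2 * h (k p.1 * p.2)
  have hg : ContDiff ℝ ∞ g :=
    contDiff_snd.mul (hh.comp ((hk.comp contDiff_fst).mul contDiff_snd))
  let Φ : ℝ × ℝ → ℝ × ℝ := fun p ↦ (x p.1 + g p * a p.1, y p.1 + g p * b p.1)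
  have hΦ : ContDiff ℝ ∞ Φ :=
    ((hx.comp contDiff_fst).add (hg.mul (ha.comp contDiff_fst))).prodMk
      ((hy.comp contDiff_fst).add (hg.mul (hb.comp contDiff_fst)))
  have hΦp (s : ℝ) : Function.Periodic (fun t ↦ Φ (t, s)) (2 * Real.pi) := fun t ↦ by
    simp only [Φ, g, hxp t, hyp t, hap t, hbp t, hkp t]
  let F : Circle × ℝ → ℝ × ℝ := fun q ↦ Φ (Complex.arg q.1, q.2)
  have hF (t s : ℝ) : F (Circle.exp t, s) = Φ (t, s) := by
    obtain ⟨m, hm⟩ := Circle.exp_eq_exp.1 (Circle.exp_arg (Circle.exp t))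
    simp only [F, hm]
    exact (hΦp s).int_mul m t
  have hF0 (z : Circle) : F (z, 0) = c z := by
    simp [F, Φ, g, x, y, Circle.exp_arg]
  obtain ⟨M, hM⟩ := (isCompact_Icc (a := 0) (b := 2 * Real.pi)).exists_bound_of_continuousOn
    hk.continuous.continuousOn
  have hM0 : 0 < |M| + 1 := by positivity
  obtain ⟨ε, hε, hinj, hmap⟩ := exists_injOn_map_prod_eq_restrict hΦ hF
    (by simpa only [hF0] using hc_inj) (div_pos hδ hM0) fun t ht s hs ↦ by
      refine det_fderiv_add_mul_eq_one (hd hx t) (hd hy t) (hd ha t) (hd hb t)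
        (hg.differentiable (by simp) _) (hdet t) ?_
      have hks : |k t * s| < δ := by
        rw [lt_div_iff₀ hM0] at hs
        rw [abs_mul, mul_comm]
        refine lt_of_le_of_lt (mul_le_mul_of_nonneg_left ?_ (abs_nonneg s)) hs
        exact (hM t ht).trans ((le_abs_self M).trans (by simp))
      have hev : ∀ᶠ r in 𝓝 s, |k t * r| < δ :=
        (continuous_const.mul continuous_id).abs.continuousAt.eventually_lt
          continuousAt_const hks
      filter_upwards [hev] with r hr
      have := hh1 _ hr
      simp only [g]
      change r * h (k t * r) + k t * (r * h (k t * r)) ^ 2 / 2 = r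
      linear_combination r * this
  exact ⟨ε, hε, F, contMDiff_of_comp_circleExp hΦ hF, hinj, hF0, hmap⟩
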